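/- arXiv:2010.08129 — 3 statements merged into one kernel-verified Lean document; each statement's English description precedes it below -/
import Mathlib

section
/- Let A be a C*-algebra and let a ∈ A be a positive element. Then the smallest closed linear subspace of A containing a and closed under the triple product (x, y, z) ↦ (1/2)(x y* z + z y* x) coincides with the smallest closed (non-unital) *-subalgebra of A containing a. -/
noncomputable section

/-- Two elements of a C*-algebra are *orthogonal* if `a * b* = 0` and `b* * a = 0`. -/
def CStar.orth {A : Type*} [NonUnitalCStarAlgebra A] (a b : A) : Prop :=
  a * star b = 0 ∧ star b * a = 0

/-- The triple product `{x,y,z} = (1/2)(x y* z + z y* x)` on a C*-algebra. -/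
def CStar.tp {A : Type*} [NonUnitalCStarAlgebra A] (x y z : A) : A :=
  (2 : ℂ)⁻¹ • (x * star y * z + z * star y * x)

open CStar

/-- A closed subtriple of a C*-algebra: a closed linear subspace closed under the triple
product. -/
def CStar.IsClosedSubtriple {A : Type*} [NonUnitalCStarAlgebra A] (S : Set A) : Prop :=
  IsClosed S ∧ (0 : A) ∈ S ∧ (∀ x y : A, x ∈ S → y ∈ S → x + y ∈ S) ∧
    (∀ (c : ℂ) (x : A), x ∈ S → c • x ∈ S) ∧
    ∀ x y z : A, x ∈ S → y ∈ S → z ∈ S → tp x y z ∈ S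


/-- A closed (non-unital) *-subalgebra of a C*-algebra: a closed linear subspace closed under
multiplication and the involution. -/
def CStar.IsClosedStarSubalgebra {A : Type*} [NonUnitalCStarAlgebra A] (S : Set A) : Prop :=
  IsClosed S ∧ (0 : A) ∈ S ∧ (∀ x y : A, x ∈ S → y ∈ S → x + y ∈ S) ∧
    (∀ (c : ℂ) (x : A), x ∈ S → c • x ∈ S) ∧
    (∀ x y : A, x ∈ S → y ∈ S → x * y ∈ S) ∧
    ∀ x : A, x ∈ S → star x ∈ S

/-- A closed *-subalgebra is a closed subtriple. -/
lemma CStar.IsClosedStarSubalgebra.isClosedSubtriple {A : Type*} [NonUnitalCStarAlgebra A]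
    {S : Set A} (hS : IsClosedStarSubalgebra S) : IsClosedSubtriple S := by
  obtain ⟨hcl, h0, hadd, hsmul, hmul, hstar⟩ := hS
  refine ⟨hcl, h0, hadd, hsmul, fun x y z hx hy hz ↦ hsmul _ _ (hadd _ _ ?_ ?_)⟩
  · exact hmul _ _ (hmul _ _ hx (hstar _ hy)) hz
  · exact hmul _ _ (hmul _ _ hz (hstar _ hy)) hx

/-- The elemental *-subalgebra is a closed *-subalgebra. -/
lemma CStar.isClosedStarSubalgebra_elemental {A : Type*} [NonUnitalCStarAlgebra A] (a : A) :
    IsClosedStarSubalgebra (NonUnitalStarAlgebra.elemental ℂ a : Set A) :=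
  ⟨NonUnitalStarAlgebra.elemental.isClosed ℂ a, zero_mem _, fun _ _ ↦ add_mem,
    fun c _ hx ↦ SMulMemClass.smul_mem c hx, fun _ _ ↦ mul_mem, fun _ ↦ star_mem⟩

namespace CStar.IsClosedSubtriple

variable {A : Type*} [NonUnitalCStarAlgebra A] {S : Set A} {a : A}

/-- A closed subtriple containing `a` and `cfcₙ f a` contains `cfcₙ (x ↦ x * f x * x) a`. -/
lemma cfcₙ_mul_mul_mem (hS : IsClosedSubtriple S) (haS : a ∈ S) (ha : IsSelfAdjoint a)
    {f : ℝ → ℝ} (hf : Continuous f) (hf0 : f 0 = 0) (hfS : cfcₙ f a ∈ S) :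
    cfcₙ (fun x : ℝ ↦ x * f x * x) a ∈ S := by
  have key : tp a (cfcₙ f a) a = cfcₙ (fun x : ℝ ↦ x * f x * x) a := by
    have hstar : star (cfcₙ f a) = cfcₙ f a := (cfcₙ_predicate f a : IsSelfAdjoint _)
    rw [tp, hstar, ← two_smul ℂ, smul_smul, inv_mul_cancel₀ two_ne_zero, one_smul,
      cfcₙ_mul (fun x ↦ x * f x) (fun x ↦ x) a (by fun_prop) (by simp) (by fun_prop) rfl,
      cfcₙ_mul (fun x ↦ x) f a (by fun_prop) rfl (by fun_prop) hf0, cfcₙ_id' ℝ a]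
  exact key ▸ hS.2.2.2.2 _ _ _ haS hfS haS

/-- A closed subtriple containing a self-adjoint element contains its odd powers. -/
lemma cfcₙ_odd_pow_mem (hS : IsClosedSubtriple S) (haS : a ∈ S) (ha : IsSelfAdjoint a) (n : ℕ) :
    cfcₙ (fun x : ℝ ↦ x ^ (2 * n + 1)) a ∈ S := by
  induction n with
  | zero => simpa [cfcₙ_id' ℝ a] using haS
  | succ n ih =>
    convert hS.cfcₙ_mul_mul_mem haS ha (by fun_prop) (by simp) ih using 3
    ring

/-- A closed subtriple containing a self-adjoint element contains its images under odd
polynomials. -/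
lemma cfcₙ_odd_polynomial_mem (hS : IsClosedSubtriple S) (haS : a ∈ S) (ha : IsSelfAdjoint a)
    (p : Polynomial ℝ) : cfcₙ (fun x : ℝ ↦ x * p.eval (x ^ 2)) a ∈ S := by
  induction p using Polynomial.induction_on' with
  | add p q hp hq =>
    simp only [Polynomial.eval_add, mul_add]
    rw [cfcₙ_add (fun x ↦ x * p.eval (x ^ 2)) (fun x ↦ x * q.eval (x ^ 2)) a (by fun_prop)
      (by simp) (by fun_prop) (by simp)]
    exact hS.2.2.1 _ _ hp hq
  | monomial n c =>
    have h : (fun x : ℝ ↦ x * (Polynomial.monomial n c).eval (x ^ 2)) =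
        fun x ↦ c * x ^ (2 * n + 1) := by
      ext x
      rw [Polynomial.eval_monomial]
      ring
    rw [h, cfcₙ_const_mul c _ a (by fun_prop) (by simp), ← Complex.coe_smul]
    exact hS.2.2.2.1 _ _ (hS.cfcₙ_odd_pow_mem haS ha n)

variable [PartialOrder A] [StarOrderedRing A]

/-- A closed subtriple containing a positive element contains its square: on `[0, ‖a‖]` the
function `x ^ 2 = x * √(x ^ 2)` is a uniform limit of odd polynomials. -/
lemma cfcₙ_sq_mem (hS : IsClosedSubtriple S) (haS : a ∈ S) (ha : 0 ≤ a) :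
    cfcₙ (fun x : ℝ ↦ x ^ 2) a ∈ S := by
  rw [← hS.1.closure_eq, Metric.mem_closure_iff]
  intro ε hε
  have hM : 0 < ‖a‖ + 1 := by positivity
  obtain ⟨p, hp⟩ := exists_polynomial_near_of_continuousOn 0 ((‖a‖ + 1) ^ 2) Real.sqrt
    Real.continuous_sqrt.continuousOn (ε / (2 * (‖a‖ + 1))) (by positivity)
  refine ⟨_, hS.cfcₙ_odd_polynomial_mem haS ha.isSelfAdjoint p, ?_⟩
  rw [dist_eq_norm, ← cfcₙ_sub _ _ a (by fun_prop) (by simp) (by fun_prop) (by simp)]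
  refine (norm_cfcₙ_le (c := ε / 2) (fun x hx ↦ ?_)).trans_lt (half_lt_self hε)
  have hx0 : 0 ≤ x := quasispectrum_nonneg_of_nonneg a ha x hx
  have hxM : x ≤ ‖a‖ + 1 := by
    have := NonUnitalIsometricContinuousFunctionalCalculus.norm_quasispectrum_le a hx
      ha.isSelfAdjoint
    rw [Real.norm_of_nonneg hx0] at this
    linarith
  have hpx := (hp (x ^ 2) ⟨by positivity, by gcongr⟩).le
  rw [Real.sqrt_sq hx0] at hpx
  calc ‖x ^ 2 - x * p.eval (x ^ 2)‖ = x * |p.eval (x ^ 2) - x| := by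
        rw [Real.norm_eq_abs, sq, ← mul_sub, abs_mul, abs_of_nonneg hx0, abs_sub_comm]
    _ ≤ (‖a‖ + 1) * (ε / (2 * (‖a‖ + 1))) := by gcongr
    _ = ε / 2 := by field_simp

/-- A closed subtriple containing a positive element contains all its powers. -/
lemma cfcₙ_pow_mem (hS : IsClosedSubtriple S) (haS : a ∈ S) (ha : 0 ≤ a) (n : ℕ) :
    cfcₙ (fun x : ℝ ↦ x ^ (n + 1)) a ∈ S := by
  induction n using Nat.twoStepInduction with
  | zero => simpa [cfcₙ_id' ℝ a ha.isSelfAdjoint] using haS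
  | one => exact hS.cfcₙ_sq_mem haS ha
  | more n ih _ =>
    convert hS.cfcₙ_mul_mul_mem haS ha.isSelfAdjoint (by fun_prop) (by simp) ih using 3
    ring

/-- A closed subtriple containing a positive element contains the *-subalgebra it generates. -/
lemma elemental_subset (hS : IsClosedSubtriple S) (haS : a ∈ S) (ha : 0 ≤ a) :
    (NonUnitalStarAlgebra.elemental ℂ a : Set A) ⊆ S := by
  refine closure_minimal (fun x hx ↦ ?_) hS.1
  replace hx : x ∈ Submodule.span ℂ (Subsemigroup.closure ({a} ∪ star {a} : Set A) : Set A) := by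
    rw [← NonUnitalStarAlgebra.adjoin_eq_span]
    exact hx
  have hpow : ∀ y ∈ Subsemigroup.closure ({a} ∪ star {a} : Set A),
      ∃ n : ℕ, y = cfcₙ (fun x : ℝ ↦ x ^ (n + 1)) a := by
    intro y hy
    induction hy using Subsemigroup.closure_induction with
    | mem y hy =>
      rw [Set.star_singleton, ha.isSelfAdjoint.star_eq, Set.union_self] at hy
      exact ⟨0, by simpa [cfcₙ_id' ℝ a ha.isSelfAdjoint] using hy⟩
    | mul y z _ _ hy hz =>
      obtain ⟨m, rfl⟩ := hy
      obtain ⟨n, rfl⟩ := hz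
      refine ⟨m + n + 1, ?_⟩
      rw [← cfcₙ_mul _ _ a (by fun_prop) (by simp) (by fun_prop) (by simp)]
      congr 1
      ext x
      ring
  induction hx using Submodule.span_induction with
  | mem y hy =>
    obtain ⟨n, rfl⟩ := hpow y hy
    exact hS.cfcₙ_pow_mem haS ha n
  | zero => exact hS.2.1
  | add y z _ _ hy hz => exact hS.2.2.1 _ _ hy hz
  | smul c y _ hy => exact hS.2.2.2.1 _ _ hy

end CStar.IsClosedSubtriple

/-- For a positive element `a` of a C*-algebra, the closed subtriple generated by `a`
coincides with the closed *-subalgebra generated by `a`. -/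
theorem closed_subtriple_generated_eq_starSubalgebra_generated {A : Type*}
    [NonUnitalCStarAlgebra A] [PartialOrder A] [StarOrderedRing A] (a : A) (ha : 0 ≤ a) :
    ⋂₀ {S : Set A | IsClosedSubtriple S ∧ a ∈ S} =
      ⋂₀ {S : Set A | IsClosedStarSubalgebra S ∧ a ∈ S} := by
  refine Set.Subset.antisymm (Set.sInter_subset_sInter fun S hS ↦ ⟨hS.1.isClosedSubtriple, hS.2⟩)
    (Set.subset_sInter fun S hS ↦ ?_)
  exact Set.sInter_subset_of_mem (show _ ∧ _ from ⟨isClosedStarSubalgebra_elemental a,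
    NonUnitalStarAlgebra.elemental.self_mem ℂ a⟩) |>.trans (hS.1.elemental_subset hS.2 ha)
end
end

section
/- Let A be a C*-algebra and let a, z ∈ A satisfy z z* z = a. Then z belongs to the smallest closed linear subspace of A containing a and closed under the triple product (x, y, w) ↦ (1/2)(x y* w + w y* x); that is, every cubic root of a lies in the closed subtriple of A generated by a. -/
noncomputable section

open CStar

/-- Right multiplication by an element of the real C*-algebra generated by `a* a` maps `a` into
every closed subtriple containing `a`. -/
theorem CStar.IsClosedSubtriple.mul_mem_of_mem_elemental {A : Type*} [NonUnitalCStarAlgebra A]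
    {S : Set A} (hS : IsClosedSubtriple S) {a y : A} (ha : a ∈ S)
    (hy : y ∈ NonUnitalStarAlgebra.elemental ℝ (star a * a)) : a * y ∈ S := by
  obtain ⟨hcl, h0, hadd, hsmul, htp⟩ := hS
  let T : Set A := {x | x ∈ S ∧ x * (star a * a) = a * star a * x}
  have hTcl : IsClosed T := hcl.inter (isClosed_eq (by fun_prop) (by fun_prop))
  have hT0 : (0 : A) ∈ T := ⟨h0, by simp⟩
  have hTadd : ∀ u v, u ∈ T → v ∈ T → u + v ∈ T := fun u v hu hv ↦
    ⟨hadd u v hu.1 hv.1, by rw [add_mul, mul_add, hu.2, hv.2]⟩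
  have hTsmul : ∀ (r : ℝ) u, u ∈ T → r • u ∈ T := fun r u hu ↦
    ⟨by simpa using hsmul (r : ℂ) u hu.1, by rw [smul_mul_assoc, mul_smul_comm, hu.2]⟩
  have hTmul : ∀ u ∈ T, u * (star a * a) ∈ T := by
    intro u hu
    refine ⟨?_, ?_⟩
    · have h := htp u a a hu.1 ha ha
      have heq : tp u a a = u * (star a * a) := by
        rw [tp, mul_assoc u, ← hu.2, ← two_smul ℂ, smul_smul]
        norm_num
      rwa [heq] at h
    · rw [hu.2, mul_assoc (a * star a), hu.2]
  let R : NonUnitalStarSubalgebra ℝ A :=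
    { carrier := {y | (∀ x ∈ T, x * y ∈ T) ∧ ∀ x ∈ T, x * star y ∈ T}
      zero_mem' := by simp [hT0]
      add_mem' := fun {u v} hu hv ↦
        ⟨fun x hx ↦ by rw [mul_add]; exact hTadd _ _ (hu.1 x hx) (hv.1 x hx),
         fun x hx ↦ by rw [star_add, mul_add]; exact hTadd _ _ (hu.2 x hx) (hv.2 x hx)⟩
      mul_mem' := fun {u v} hu hv ↦
        ⟨fun x hx ↦ by rw [← mul_assoc]; exact hv.1 _ (hu.1 x hx),
         fun x hx ↦ by rw [star_mul, ← mul_assoc]; exact hu.2 _ (hv.2 x hx)⟩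
      smul_mem' := fun r u hu ↦
        ⟨fun x hx ↦ by rw [mul_smul_comm]; exact hTsmul r _ (hu.1 x hx),
         fun x hx ↦ by
          rw [star_smul, star_trivial, mul_smul_comm]; exact hTsmul r _ (hu.2 x hx)⟩
      star_mem' := fun {u} hu ↦ ⟨hu.2, by simpa using hu.1⟩ }
  have hRcl : IsClosed (R : Set A) := by
    have : (R : Set A) = (⋂ x ∈ T, (fun y ↦ x * y) ⁻¹' T) ∩
        ⋂ x ∈ T, (fun y ↦ x * star y) ⁻¹' T := by
      ext y
      simp only [Set.mem_inter_iff, Set.mem_iInter, Set.mem_preimage]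
      rfl
    rw [this]
    exact (isClosed_biInter fun x _ ↦ hTcl.preimage (by fun_prop)).inter
      (isClosed_biInter fun x _ ↦ hTcl.preimage (by fun_prop))
  have hR : star a * a ∈ R := ⟨hTmul, by simpa using hTmul⟩
  exact ((NonUnitalStarAlgebra.elemental.le_of_mem hRcl hR hy).1 a ⟨ha, by simp [mul_assoc]⟩).1

theorem mul_sq_one_sub_cube_div_le {t δ : ℝ} (ht : 0 ≤ t) (hδ : 0 < δ) :
    t * (1 - t ^ 3 / (t ^ 3 + δ ^ 3)) ^ 2 ≤ δ := by
  have hpos : 0 < t ^ 3 + δ ^ 3 := by positivity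
  have h1 : 1 - t ^ 3 / (t ^ 3 + δ ^ 3) = δ ^ 3 / (t ^ 3 + δ ^ 3) := by field_simp; ring
  rw [h1, div_pow, mul_div_assoc', div_le_iff₀ (by positivity)]
  rcases le_total t δ with h | h
  · have h2 : (δ ^ 3) ^ 2 ≤ (t ^ 3 + δ ^ 3) ^ 2 := by
      gcongr
      exact le_add_of_nonneg_left (by positivity)
    exact mul_le_mul h h2 (by positivity) hδ.le
  · have h2 : δ ^ 5 ≤ t ^ 5 := by gcongr
    have h3 : t * δ * δ ^ 5 ≤ t * δ * t ^ 5 := by gcongr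
    have h4 : 0 ≤ δ * (2 * t ^ 3 * δ ^ 3 + δ ^ 6) := by positivity
    nlinarith

theorem exists_continuous_mul_comp_cube_eq {δ : ℝ} (hδ : 0 < δ) :
    ∃ h : ℝ → ℝ, Continuous h ∧ h 0 = 0 ∧
      ∀ t, 0 ≤ t → t * h (t * (t * t)) = t ^ 3 / (t ^ 3 + δ ^ 3) := by
  refine ⟨fun s ↦ (|s| ^ (3⁻¹ : ℝ)) ^ 2 / (|s| + δ ^ 3), ?_, by simp, fun t ht ↦ ?_⟩
  · refine Continuous.div ?_ (by fun_prop) fun s ↦ by positivity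
    exact (continuous_abs.rpow_const fun _ ↦ Or.inr (by norm_num)).pow 2
  · have h3 : t * (t * t) = t ^ 3 := by ring
    have hroot : (t ^ 3) ^ (3⁻¹ : ℝ) = t := by
      simpa using Real.pow_rpow_inv_natCast ht three_ne_zero
    simp only [h3, abs_of_nonneg (pow_nonneg ht 3), hroot]
    ring

/-- For `b = z* z`, the function `t ↦ t³ / (t³ + δ³)` of `b` is an approximate right unit
for `z`. -/
theorem norm_sub_mul_cfcₙ_sq_le {A : Type*} [NonUnitalCStarAlgebra A] (z : A) {δ : ℝ}
    (hδ : 0 < δ) {f : ℝ → ℝ} (hf : Continuous f)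
    (hft : ∀ t, 0 ≤ t → f t = t ^ 3 / (t ^ 3 + δ ^ 3)) :
    ‖z - z * cfcₙ f (star z * z)‖ ^ 2 ≤ δ := by
  let _ := CStarAlgebra.spectralOrder A
  have := CStarAlgebra.spectralOrderedRing A
  have hb : IsSelfAdjoint (star z * z) := .star_mul_self z
  have hf0 : f 0 = 0 := by simp [hft 0 le_rfl]
  have hstar : star (cfcₙ f (star z * z)) = cfcₙ f (star z * z) :=
    (cfcₙ_predicate f _ : IsSelfAdjoint (cfcₙ f (star z * z))).star_eq
  have hexp : star (z - z * cfcₙ f (star z * z)) * (z - z * cfcₙ f (star z * z)) =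
      cfcₙ (fun t ↦ (t - t * f t) - f t * (t - t * f t)) (star z * z) := by
    rw [cfcₙ_sub (fun t ↦ t - t * f t) (fun t ↦ f t * (t - t * f t)) (star z * z),
      cfcₙ_mul f (fun t ↦ t - t * f t) (star z * z),
      cfcₙ_sub (fun t ↦ t) (fun t ↦ t * f t) (star z * z),
      cfcₙ_mul (fun t ↦ t) f (star z * z), cfcₙ_id' ℝ (star z * z), star_sub, star_mul, hstar]
    noncomm_ring
  rw [sq, ← CStarRing.norm_star_mul_self, hexp]
  refine norm_cfcₙ_le fun t ht ↦ ?_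
  have ht0 : 0 ≤ t := quasispectrum_nonneg_of_nonneg _ (star_mul_self_nonneg z) t ht
  have heq : (t - t * f t) - f t * (t - t * f t) = t * (1 - f t) ^ 2 := by ring
  rw [heq, Real.norm_of_nonneg (by positivity), hft t ht0]
  exact mul_sq_one_sub_cube_div_le ht0 hδ

/-- Every cubic root of an element `a` of a C*-algebra lies in the closed subtriple generated
by `a`. -/
theorem cubicRoot_mem_closed_subtriple {A : Type*} [NonUnitalCStarAlgebra A] (a z : A)
    (hz : z * star z * z = a) :
    z ∈ ⋂₀ {S : Set A | IsClosedSubtriple S ∧ a ∈ S} := by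
  rintro S ⟨hS, ha⟩
  rw [← hS.1.closure_eq, Metric.mem_closure_iff]
  intro ε hε
  set δ : ℝ := (ε / 2) ^ 2 with hδdef
  have hδ : 0 < δ := by positivity
  have hb : IsSelfAdjoint (star z * z) := .star_mul_self z
  obtain ⟨h, hh, hh0, hft⟩ := exists_continuous_mul_comp_cube_eq hδ
  have hcube : star a * a = cfcₙ (fun t : ℝ ↦ t * (t * t)) (star z * z) := by
    rw [cfcₙ_mul (fun t : ℝ ↦ t) (fun t ↦ t * t) (star z * z),
      cfcₙ_mul (fun t : ℝ ↦ t) (fun t ↦ t) (star z * z), cfcₙ_id' ℝ (star z * z), ← hz]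
    simp only [star_mul, star_star, mul_assoc]
  have hmul : z * cfcₙ (fun t ↦ t * h (t * (t * t))) (star z * z) = a * cfcₙ h (star a * a) := by
    rw [cfcₙ_mul (fun t ↦ t) (fun t ↦ h (t * (t * t))) (star z * z), cfcₙ_id' ℝ (star z * z),
      cfcₙ_comp' h (fun t ↦ t * (t * t)) (star z * z) hh.continuousOn hh0, ← hcube, ← hz]
    simp only [mul_assoc]
  refine ⟨a * cfcₙ h (star a * a),
    hS.mul_mem_of_mem_elemental ha (cfcₙ_mem_elemental h (star a * a)), ?_⟩
  have hle := norm_sub_mul_cfcₙ_sq_le z hδ (by fun_prop) hft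
  rw [hmul, hδdef] at hle
  rw [dist_eq_norm]
  exact (le_of_sq_le_sq hle (by positivity)).trans_lt (half_lt_self hε)
end
end

section
/- Let A and B be unital C*-algebras and let T : A → B be a surjective orthogonality preserving bounded linear operator. Then: (i) the element h := T(1) is invertible in B; (ii) writing u := h (h* h)^{-1/2} for the unitary factor in the polar decomposition of h, the element h u* lies in the center of B (it commutes with every element of B); and (iii) there exists a surjective bounded linear map S : A → B which preserves the triple product, i.e., S{x,y,z} = {S(x),S(y),S(z)} for all x, y, z ∈ A, such that ker S = ker T and T(x) = h u* S(x) for every x ∈ A. -/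
noncomputable section

open CStar
/-- The unitary factor `u = h (h* h)^{-1/2}` in the polar decomposition of an invertible
element `h` of a unital C*-algebra. -/
def CStar.polarUnitary {B : Type*} [CStarAlgebra B] [PartialOrder B] [StarOrderedRing B]
    (h : B) : B :=
  h * Ring.inverse (CFC.sqrt (star h * h))

namespace OrthBilin

variable {K X : Type*} [TopologicalSpace K]

/-- The truncation of `F` to the set where `p < y`, continuous when `F` vanishes where `y = p`. -/
def cut (y F : C(K, ℝ)) (p : ℝ) (hF : ∀ t, y t = p → F t = 0) : C(K, ℝ) where
  toFun t := if y t ≤ p then 0 else F t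
  continuous_toFun := Continuous.if_le continuous_const F.continuous y.continuous
    continuous_const fun t ht => (hF t ht).symm

lemma abs_sub_sum_step_le (c : ℝ) (hc : 0 ≤ c) (hc1 : c ≤ 1) (N : ℕ) (y : ℝ) (hy : 0 ≤ y)
    (hyN : y ≤ N) : |y - ∑ k ∈ Finset.range N, (if y ≤ k + c then (0 : ℝ) else 1)| ≤ 1 := by
  induction N with
  | zero =>
    have : y = 0 := le_antisymm (by simpa using hyN) hy
    simp [this]
  | succ N ih =>
    rw [Finset.sum_range_succ]
    rcases le_or_gt y N with h | h
    · rw [if_pos (by linarith), add_zero]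
      exact ih h
    · have h1 : ∀ k ∈ Finset.range N, (if y ≤ k + c then (0 : ℝ) else 1) = 1 := by
        intro k hk
        have : (k : ℝ) + 1 ≤ N := by exact_mod_cast Finset.mem_range.mp hk
        rw [if_neg (by linarith)]
      rw [Finset.sum_congr rfl h1]
      push_cast at hyN
      simp only [Finset.sum_const, Finset.card_range, nsmul_eq_mul, mul_one]
      split_ifs <;> rw [abs_le] <;> constructor <;> linarith

lemma map_cut_left [AddCommGroup X] [Module ℝ X]
    (V : C(K, ℝ) →ₗ[ℝ] C(K, ℝ) →ₗ[ℝ] X) (hV : ∀ f g, f * g = 0 → V f g = 0)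
    (y F G : C(K, ℝ)) (p : ℝ) (hF : ∀ t, y t = p → F t = 0) (hG : ∀ t, y t = p → G t = 0) :
    V (cut y F p hF) G = V F (cut y G p hG) := by
  have h1 : V (cut y F p hF) (G - cut y G p hG) = 0 := by
    refine hV _ _ (ContinuousMap.ext fun t => ?_)
    simp only [cut, ContinuousMap.mul_apply, ContinuousMap.sub_apply, ContinuousMap.coe_mk,
      ContinuousMap.zero_apply]
    split_ifs <;> simp
  have h2 : V (F - cut y F p hF) (cut y G p hG) = 0 := by
    refine hV _ _ (ContinuousMap.ext fun t => ?_)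
    simp only [cut, ContinuousMap.mul_apply, ContinuousMap.sub_apply, ContinuousMap.coe_mk,
      ContinuousMap.zero_apply]
    split_ifs <;> simp
  rw [map_sub, sub_eq_zero] at h1
  rw [map_sub, LinearMap.sub_apply, sub_eq_zero] at h2
  rw [h1, h2]

/-- The function `(1 + 2 cos (2π (y - i/3))) / 3`: it is bounded by `1`, vanishes where
`y ∈ ℤ + m/3` for `m ≠ i` modulo `3`, and the three functions `i = 0, 1, 2` sum to `1`. -/
def wave (y : C(K, ℝ)) (i : Fin 3) : C(K, ℝ) where
  toFun t := (1 + 2 * Real.cos (2 * Real.pi * y t - i.val * (2 * Real.pi / 3))) / 3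

lemma cos_two_pi_div_three : Real.cos (2 * Real.pi / 3) = -(1 / 2) := by
  rw [show 2 * Real.pi / 3 = Real.pi - Real.pi / 3 by ring, Real.cos_pi_sub, Real.cos_pi_div_three]

lemma cos_four_pi_div_three : Real.cos (4 * Real.pi / 3) = -(1 / 2) := by
  rw [show 4 * Real.pi / 3 = Real.pi / 3 + Real.pi by ring, Real.cos_add_pi,
    Real.cos_pi_div_three]

lemma sum_wave (y : C(K, ℝ)) : ∑ i, wave y i = 1 := by
  ext t
  have h1 : Real.sin (4 * Real.pi / 3) = - Real.sin (2 * Real.pi / 3) := by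
    rw [show 4 * Real.pi / 3 = Real.pi / 3 + Real.pi by ring, Real.sin_add_pi,
      show 2 * Real.pi / 3 = Real.pi - Real.pi / 3 by ring, Real.sin_pi_sub]
  have h2 : (2 : ℝ) * (2 * Real.pi / 3) = 4 * Real.pi / 3 := by ring
  simp only [wave, Fin.sum_univ_three, ContinuousMap.add_apply, ContinuousMap.coe_mk,
    ContinuousMap.one_apply, Fin.val_zero, Fin.val_one, Fin.val_two, Nat.cast_zero, Nat.cast_one,
    Nat.cast_ofNat, zero_mul, one_mul, sub_zero, h2]
  simp only [Real.cos_sub, cos_two_pi_div_three, cos_four_pi_div_three, h1]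
  ring

lemma wave_eq_zero (y : C(K, ℝ)) {i m : Fin 3} (him : m ≠ i) (k : ℕ) (t : K)
    (ht : y t = k + m.val / 3) : wave y i t = 0 := by
  have h : Real.cos (2 * Real.pi * y t - i.val * (2 * Real.pi / 3)) = -(1 / 2) := by
    rw [ht, show 2 * Real.pi * ((k : ℝ) + m.val / 3) - i.val * (2 * Real.pi / 3) =
      ((m.val : ℝ) - i.val) * (2 * Real.pi / 3) + k * (2 * Real.pi) by ring,
      Real.cos_add_nat_mul_two_pi]
    have h2 : (2 : ℝ) * (2 * Real.pi / 3) = 4 * Real.pi / 3 := by ring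
    fin_cases i <;> fin_cases m <;> first | exact absurd rfl him | skip
    all_goals norm_num [cos_two_pi_div_three, cos_four_pi_div_three, h2]
  simp only [wave, ContinuousMap.coe_mk, h]
  norm_num

variable [CompactSpace K] [NormedAddCommGroup X] [NormedSpace ℝ X]

lemma norm_mul_sub_sum_cut_le (y F : C(K, ℝ)) (c : ℝ) (hc : 0 ≤ c) (hc1 : c ≤ 1) (N : ℕ)
    (hy : ∀ t, 0 ≤ y t) (hyN : ∀ t, y t ≤ N) (hF : ∀ k : ℕ, ∀ t, y t = k + c → F t = 0) :
    ‖y * F - ∑ k ∈ Finset.range N, cut y F (k + c) (hF k)‖ ≤ ‖F‖ := by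
  rw [ContinuousMap.norm_le _ (norm_nonneg _)]
  intro t
  have h : (y * F - ∑ k ∈ Finset.range N, cut y F (k + c) (hF k)) t =
      (y t - ∑ k ∈ Finset.range N, (if y t ≤ k + c then (0 : ℝ) else 1)) * F t := by
    simp only [cut, ContinuousMap.sub_apply, ContinuousMap.mul_apply, ContinuousMap.sum_apply,
      ContinuousMap.coe_mk, sub_mul, Finset.sum_mul, ite_mul, zero_mul, one_mul]
  rw [h, norm_mul, Real.norm_eq_abs]
  calc _ ≤ 1 * ‖F t‖ := by
        gcongr
        exact abs_sub_sum_step_le c hc hc1 N _ (hy t) (hyN t)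
    _ ≤ ‖F‖ := by rw [one_mul]; exact F.norm_coe_le_norm t

lemma norm_commutator_le_of_vanishing (V : C(K, ℝ) →ₗ[ℝ] C(K, ℝ) →ₗ[ℝ] X)
    {M : ℝ} (hM0 : 0 ≤ M)
    (hM : ∀ f g, ‖V f g‖ ≤ M * ‖f‖ * ‖g‖) (hV : ∀ f g, f * g = 0 → V f g = 0)
    (y F G : C(K, ℝ)) (c : ℝ) (hc : 0 ≤ c) (hc1 : c ≤ 1)
    (N : ℕ) (hy : ∀ t, 0 ≤ y t) (hyN : ∀ t, y t ≤ N)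
    (hF : ∀ k : ℕ, ∀ t, y t = k + c → F t = 0) (hG : ∀ k : ℕ, ∀ t, y t = k + c → G t = 0) :
    ‖V (y * F) G - V F (y * G)‖ ≤ 2 * (M * ‖F‖ * ‖G‖) := by
  have key : V (∑ k ∈ Finset.range N, cut y F (k + c) (hF k)) G =
      V F (∑ k ∈ Finset.range N, cut y G (k + c) (hG k)) := by
    rw [map_sum, map_sum, LinearMap.sum_apply]
    exact Finset.sum_congr rfl fun k _ => map_cut_left V hV y F G _ _ _
  have hFn := norm_mul_sub_sum_cut_le y F c hc hc1 N hy hyN hF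
  have hGn := norm_mul_sub_sum_cut_le y G c hc hc1 N hy hyN hG
  have h : V (y * F) G - V F (y * G) =
      V (y * F - ∑ k ∈ Finset.range N, cut y F (k + c) (hF k)) G -
        V F (y * G - ∑ k ∈ Finset.range N, cut y G (k + c) (hG k)) := by
    rw [map_sub, map_sub, LinearMap.sub_apply, key]
    abel
  rw [h]
  calc _ ≤ _ := norm_sub_le _ _
    _ ≤ M * ‖F‖ * ‖G‖ + M * ‖F‖ * ‖G‖ := by
      gcongr
      · refine (hM _ _).trans ?_
        gcongr
      · refine (hM _ _).trans ?_
        gcongr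
    _ = _ := by ring

lemma norm_wave_mul_le (y f : C(K, ℝ)) (i : Fin 3) : ‖wave y i * f‖ ≤ ‖f‖ := by
  rw [ContinuousMap.norm_le _ (norm_nonneg _)]
  intro t
  rw [ContinuousMap.mul_apply, norm_mul]
  refine (mul_le_of_le_one_left (norm_nonneg _) ?_).trans (f.norm_coe_le_norm t)
  have h1 := Real.cos_le_one (2 * Real.pi * y t - i.val * (2 * Real.pi / 3))
  have h2 := Real.neg_one_le_cos (2 * Real.pi * y t - i.val * (2 * Real.pi / 3))
  rw [Real.norm_eq_abs, abs_le]
  simp only [wave, ContinuousMap.coe_mk]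
  constructor <;> linarith

lemma norm_commutator_le (V : C(K, ℝ) →ₗ[ℝ] C(K, ℝ) →ₗ[ℝ] X)
    {M : ℝ} (hM0 : 0 ≤ M)
    (hM : ∀ f g, ‖V f g‖ ≤ M * ‖f‖ * ‖g‖) (hV : ∀ f g, f * g = 0 → V f g = 0)
    (y f g : C(K, ℝ)) (N : ℕ) (hy : ∀ t, 0 ≤ y t)
    (hyN : ∀ t, y t ≤ N) :
    ‖V (y * f) g - V f (y * g)‖ ≤ 18 * (M * ‖f‖ * ‖g‖) := by
  have hf : ∑ i, wave y i * f = f := by rw [← Finset.sum_mul, sum_wave, one_mul]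
  have hg : ∑ i, wave y i * g = g := by rw [← Finset.sum_mul, sum_wave, one_mul]
  have h : V (y * f) g - V f (y * g) = ∑ i, ∑ j,
      (V (y * (wave y i * f)) (wave y j * g) - V (wave y i * f) (y * (wave y j * g))) := by
    conv_lhs => rw [← hf, ← hg]
    simp only [Finset.mul_sum, map_sum, LinearMap.sum_apply, Finset.sum_sub_distrib]
    rw [Finset.sum_comm, sub_right_inj, Finset.sum_comm]
  have hij : ∀ i j, ‖V (y * (wave y i * f)) (wave y j * g) -
      V (wave y i * f) (y * (wave y j * g))‖ ≤ 2 * (M * ‖f‖ * ‖g‖) := by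
    intro i j
    obtain ⟨m, hmi, hmj⟩ : ∃ m : Fin 3, m ≠ i ∧ m ≠ j := by
      revert i j
      decide
    have hm : (m.val : ℝ) ≤ 2 := by exact_mod_cast Nat.le_of_lt_succ m.isLt
    refine (norm_commutator_le_of_vanishing V hM0 hM hV y _ _ (m.val / 3) (by positivity)
      (by linarith) N hy hyN (fun k t ht => ?_) fun k t ht => ?_).trans ?_
    · rw [ContinuousMap.mul_apply, wave_eq_zero y hmi k t ht, zero_mul]
    · rw [ContinuousMap.mul_apply, wave_eq_zero y hmj k t ht, zero_mul]
    · gcongr <;> exact norm_wave_mul_le _ _ _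
  rw [h]
  refine (norm_sum_le_of_le _ fun i _ => norm_sum_le_of_le _ fun j _ => hij i j).trans ?_
  simp only [Finset.sum_const, Finset.card_univ, Fintype.card_fin, nsmul_eq_mul]
  norm_num
  linarith

/-- A bounded bilinear map on `C(K, ℝ)` that vanishes on pairs of functions with zero product is
balanced. -/
theorem map_mul_left_eq_map_mul_right (V : C(K, ℝ) →ₗ[ℝ] C(K, ℝ) →ₗ[ℝ] X)
    {M : ℝ} (hM0 : 0 ≤ M)
    (hM : ∀ f g, ‖V f g‖ ≤ M * ‖f‖ * ‖g‖) (hV : ∀ f g, f * g = 0 → V f g = 0)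
    (x f g : C(K, ℝ)) :
    V (x * f) g = V f (x * g) := by
  have hn : ∀ n : ℕ, n * ‖V (x * f) g - V f (x * g)‖ ≤ 18 * (M * ‖f‖ * ‖g‖) := by
    intro n
    obtain ⟨N, hN⟩ := exists_nat_ge (n * (2 * ‖x‖))
    have hx : ∀ t, |x t| ≤ ‖x‖ := fun t => x.norm_coe_le_norm t
    have h := norm_commutator_le V hM0 hM hV ((n : ℝ) • (x + ‖x‖ • 1)) f g N
      (fun t => ?_) (fun t => ?_)
    · have e : V ((n : ℝ) • (x + ‖x‖ • 1) * f) g - V f ((n : ℝ) • (x + ‖x‖ • 1) * g) =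
          (n : ℝ) • (V (x * f) g - V f (x * g)) := by
        simp only [smul_mul_assoc, add_mul, one_mul, map_smul, map_add,
          LinearMap.smul_apply, LinearMap.add_apply, ← smul_sub]
        congr 1
        abel
      rwa [e, norm_smul, Real.norm_natCast] at h
    · have := (abs_le.mp (hx t)).1
      simp only [ContinuousMap.smul_apply, ContinuousMap.add_apply, ContinuousMap.one_apply,
        smul_eq_mul, mul_one]
      exact mul_nonneg (Nat.cast_nonneg _) (by linarith)
    · refine le_trans ?_ hN
      have := (abs_le.mp (hx t)).2
      simp only [ContinuousMap.smul_apply, ContinuousMap.add_apply, ContinuousMap.one_apply,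
        smul_eq_mul, mul_one]
      gcongr
      linarith
  by_contra hne
  have hpos : 0 < ‖V (x * f) g - V f (x * g)‖ := norm_pos_iff.mpr (sub_ne_zero.mpr hne)
  obtain ⟨n, h⟩ := exists_nat_gt (18 * (M * ‖f‖ * ‖g‖) / ‖V (x * f) g - V f (x * g)‖)
  rw [div_lt_iff₀ hpos] at h
  exact absurd (hn n) (not_le.mpr h)

end OrthBilin

section OrthogonalityPreserving

open scoped ComplexStarModule

variable {A B : Type*} [CStarAlgebra A] [CStarAlgebra B] {T : A →L[ℂ] B}

lemma norm_map_cfcHom_le {a : A} (ha : IsSelfAdjoint a) (f : C(spectrum ℝ a, ℝ)) :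
    ‖T (cfcHom ha f)‖ ≤ ‖T‖ * ‖f‖ := by
  rw [← norm_cfcHom a f ha]
  exact T.le_opNorm _

lemma orth_cfcHom {a : A} (ha : IsSelfAdjoint a) {f g : C(spectrum ℝ a, ℝ)} (h : f * g = 0) :
    orth (cfcHom ha f) (cfcHom ha g) := by
  rw [orth, ← map_star, ← map_mul, ← map_mul, star_trivial, mul_comm g f, h, map_zero]
  exact ⟨rfl, rfl⟩

lemma map_cfcHom_mul_mul_star (hop : ∀ a b : A, orth a b → orth (T a) (T b)) {a : A}
    (ha : IsSelfAdjoint a) (x f g : C(spectrum ℝ a, ℝ)) :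
    T (cfcHom ha (x * f)) * star (T (cfcHom ha g)) =
      T (cfcHom ha f) * star (T (cfcHom ha (x * g))) :=
  OrthBilin.map_mul_left_eq_map_mul_right
    (LinearMap.mk₂ ℝ (fun f g => T (cfcHom ha f) * star (T (cfcHom ha g)))
      (fun _ _ _ => by simp only [map_add, add_mul])
      (fun c _ _ => by simp only [map_smul, ContinuousLinearMap.map_smul_of_tower, smul_mul_assoc])
      (fun _ _ _ => by simp only [map_add, star_add, mul_add])
      (fun c _ _ => by
        simp only [map_smul, ContinuousLinearMap.map_smul_of_tower, star_smul, star_trivial,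
          mul_smul_comm]))
    (M := ‖T‖ * ‖T‖) (by positivity)
    (fun f g => by
      refine (norm_mul_le _ _).trans ?_
      rw [norm_star]
      calc _ ≤ (‖T‖ * ‖f‖) * (‖T‖ * ‖g‖) := by
            gcongr <;> exact norm_map_cfcHom_le ha _
        _ = _ := by ring)
    (fun _ _ h => (hop _ _ (orth_cfcHom ha h)).1) x f g

lemma star_mul_map_cfcHom_mul (hop : ∀ a b : A, orth a b → orth (T a) (T b)) {a : A}
    (ha : IsSelfAdjoint a) (x f g : C(spectrum ℝ a, ℝ)) :
    star (T (cfcHom ha g)) * T (cfcHom ha (x * f)) =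
      star (T (cfcHom ha (x * g))) * T (cfcHom ha f) :=
  OrthBilin.map_mul_left_eq_map_mul_right
    (LinearMap.mk₂ ℝ (fun f g => star (T (cfcHom ha g)) * T (cfcHom ha f))
      (fun _ _ _ => by simp only [map_add, mul_add])
      (fun c _ _ => by simp only [map_smul, ContinuousLinearMap.map_smul_of_tower, mul_smul_comm])
      (fun _ _ _ => by simp only [map_add, star_add, add_mul])
      (fun c _ _ => by
        simp only [map_smul, ContinuousLinearMap.map_smul_of_tower, star_smul, star_trivial,
          smul_mul_assoc]))
    (M := ‖T‖ * ‖T‖) (by positivity)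
    (fun f g => by
      refine (norm_mul_le _ _).trans ?_
      rw [norm_star]
      calc _ ≤ (‖T‖ * ‖g‖) * (‖T‖ * ‖f‖) := by
            gcongr <;> exact norm_map_cfcHom_le ha _
        _ = _ := by ring)
    (fun _ _ h => (hop _ _ (orth_cfcHom ha h)).2) x f g

lemma IsSelfAdjoint.map_mul_star_map_one (hop : ∀ a b : A, orth a b → orth (T a) (T b)) {a : A}
    (ha : IsSelfAdjoint a) : T a * star (T 1) = T 1 * star (T a) := by
  simpa [cfcHom_id] using map_cfcHom_mul_mul_star hop ha (.restrict (spectrum ℝ a) (.id ℝ)) 1 1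

lemma IsSelfAdjoint.map_sq_mul_star_map_one (hop : ∀ a b : A, orth a b → orth (T a) (T b))
    {a : A} (ha : IsSelfAdjoint a) : T (a * a) * star (T 1) = T a * star (T a) := by
  simpa [cfcHom_id] using map_cfcHom_mul_mul_star hop ha (.restrict (spectrum ℝ a) (.id ℝ))
    (.restrict (spectrum ℝ a) (.id ℝ)) 1

lemma IsSelfAdjoint.star_map_one_mul_map (hop : ∀ a b : A, orth a b → orth (T a) (T b)) {a : A}
    (ha : IsSelfAdjoint a) : star (T 1) * T a = star (T a) * T 1 := by
  simpa [cfcHom_id] using star_mul_map_cfcHom_mul hop ha (.restrict (spectrum ℝ a) (.id ℝ)) 1 1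

lemma map_mul_star_map_one (hop : ∀ a b : A, orth a b → orth (T a) (T b)) (a : A) :
    T a * star (T 1) = T 1 * star (T (star a)) := by
  rw [← realPart_add_I_smul_imaginaryPart a]
  simp only [map_add, map_smul, star_add, star_smul, (ℜ a).2.star_eq, (ℑ a).2.star_eq, add_mul,
    mul_add, smul_mul_assoc, mul_smul_comm, star_star, (ℜ a).2.map_mul_star_map_one hop,
    (ℑ a).2.map_mul_star_map_one hop]

lemma star_map_one_mul_map (hop : ∀ a b : A, orth a b → orth (T a) (T b)) (a : A) :
    star (T 1) * T a = star (T (star a)) * T 1 := by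
  rw [← realPart_add_I_smul_imaginaryPart a]
  simp only [map_add, map_smul, star_add, star_smul, (ℜ a).2.star_eq, (ℑ a).2.star_eq, add_mul,
    mul_add, smul_mul_assoc, mul_smul_comm, star_star, (ℜ a).2.star_map_one_mul_map hop,
    (ℑ a).2.star_map_one_mul_map hop]

lemma IsSelfAdjoint.map_jordan_mul_star_map_one
    (hop : ∀ a b : A, orth a b → orth (T a) (T b)) {a b : A} (ha : IsSelfAdjoint a)
    (hb : IsSelfAdjoint b) :
    T (a * b + b * a) * star (T 1) = T a * star (T b) + T b * star (T a) := by
  have h := (ha.add hb).map_sq_mul_star_map_one hop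
  have h1 : (a + b) * (a + b) = a * a + b * b + (a * b + b * a) := by noncomm_ring
  rw [h1, map_add T _ (a * b + b * a), map_add T (a * a), add_mul, add_mul,
    ha.map_sq_mul_star_map_one hop, hb.map_sq_mul_star_map_one hop, map_add T a b, star_add,
    add_mul, mul_add, mul_add] at h
  refine add_left_cancel (h.trans ?_)
  abel

lemma map_jordan_mul_star_map_one (hop : ∀ a b : A, orth a b → orth (T a) (T b)) (a b : A) :
    T (a * b + b * a) * star (T 1) = T a * star (T (star b)) + T b * star (T (star a)) := by
  have key : ∀ {b : A}, IsSelfAdjoint b → ∀ a,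
      T (a * b + b * a) * star (T 1) = T a * star (T b) + T b * star (T (star a)) := by
    intro b hb a
    have h1 := (ℜ a).2.map_jordan_mul_star_map_one hop hb
    have h2 := (ℑ a).2.map_jordan_mul_star_map_one hop hb
    rw [map_add, add_mul] at h1 h2
    rw [← realPart_add_I_smul_imaginaryPart a]
    simp only [map_add, map_smul, star_add, star_smul, (ℜ a).2.star_eq, (ℑ a).2.star_eq, add_mul,
      mul_add, smul_mul_assoc, mul_smul_comm, star_star]
    rw [add_add_add_comm, h1, ← smul_add, h2]
    module
  have h1 := key (ℜ b).2 a
  have h2 := key (ℑ b).2 a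
  rw [map_add, add_mul] at h1 h2
  rw [← realPart_add_I_smul_imaginaryPart b]
  simp only [map_add, map_smul, star_add, star_smul, (ℜ b).2.star_eq, (ℑ b).2.star_eq, add_mul,
    mul_add, smul_mul_assoc, mul_smul_comm, star_star]
  rw [add_add_add_comm, h1, ← smul_add, h2]
  module

lemma tp_eq_jordan (x y z : A) :
    tp x y z = (4 : ℂ)⁻¹ • (((x * star y + star y * x) * z + z * (x * star y + star y * x)) +
      ((z * star y + star y * z) * x + x * (z * star y + star y * z)) -
        ((x * z + z * x) * star y + star y * (x * z + z * x))) := by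
  have h : ((x * star y + star y * x) * z + z * (x * star y + star y * x)) +
      ((z * star y + star y * z) * x + x * (z * star y + star y * z)) -
        ((x * z + z * x) * star y + star y * (x * z + z * x)) =
      (2 : ℂ) • (x * star y * z + z * star y * x) := by
    rw [two_smul]
    noncomm_ring
  rw [h, smul_smul, tp]
  norm_num

lemma map_tp_of_jordan (J : A →ₗ[ℂ] B) (hstar : ∀ a, J (star a) = star (J a))
    (hmul : ∀ a b, J (a * b + b * a) = J a * J b + J b * J a) (x y z : A) :
    J (tp x y z) = tp (J x) (J y) (J z) := by
  rw [tp_eq_jordan, tp_eq_jordan, map_smul, map_sub, map_add]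
  simp only [hmul, hstar]

lemma mul_tp (u : B) (hu : star u * u = 1) (x y z : B) :
    u * tp x y z = tp (u * x) (u * y) (u * z) := by
  have h : ∀ x z : B, u * x * star (u * y) * (u * z) = u * (x * star y * z) := by
    intro x z
    rw [star_mul, ← mul_assoc (u * x), mul_assoc _ (star u), ← mul_assoc (star u), hu, one_mul]
    simp only [mul_assoc]
  rw [tp, tp, h, h, mul_smul_comm, mul_add]

lemma star_map_one_mul_map_one (hT : Function.Surjective T)
    (hop : ∀ a b : A, orth a b → orth (T a) (T b)) :
    star (T 1) * T 1 = T 1 * star (T 1) := by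
  obtain ⟨a, ha⟩ := hT 1
  have h1 := map_mul_star_map_one hop a
  have h2 := star_map_one_mul_map hop a
  rw [ha, one_mul] at h1
  rw [ha, mul_one] at h2
  nth_rw 1 [h1]
  rw [mul_assoc, ← h2]

lemma commute_star_map_one_mul_map_one (hT : Function.Surjective T)
    (hop : ∀ a b : A, orth a b → orth (T a) (T b)) (b : B) :
    Commute (star (T 1) * T 1) b := by
  obtain ⟨a, rfl⟩ := hT b
  rw [commute_iff_eq]
  nth_rw 1 [star_map_one_mul_map_one hT hop]
  rw [mul_assoc, star_map_one_mul_map hop, ← mul_assoc, ← map_mul_star_map_one hop, mul_assoc]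

lemma isUnit_map_one [PartialOrder B] [StarOrderedRing B] (hT : Function.Surjective T)
    (hop : ∀ a b : A, orth a b → orth (T a) (T b)) : IsUnit (T 1) := by
  obtain ⟨a, ha⟩ := hT 1
  have h2 := star_map_one_mul_map hop a
  rw [ha, mul_one] at h2
  have h3 := map_jordan_mul_star_map_one hop a (star a)
  rw [star_star, ha, star_one, mul_one] at h3
  have hu : IsUnit (1 + T (star a) * star (T (star a))) :=
    CStarAlgebra.isUnit_of_le 1 (le_add_of_nonneg_right (mul_star_self_nonneg _))
  rw [← h3] at hu
  obtain ⟨v, hv⟩ := hu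
  have hl : ↑v⁻¹ * T (a * star a + star a * a) * star (T (star a)) * T 1 = 1 := by
    rw [mul_assoc, ← h2, mul_assoc, ← hv, Units.inv_mul]
  have hr : T 1 * star (↑v⁻¹ * T (a * star a + star a * a)) = 1 := by
    rw [← star_star (T 1), ← star_mul, mul_assoc, ← hv, Units.inv_mul, star_one]
  exact isUnit_iff_exists_and_exists.mpr ⟨⟨_, hr⟩, ⟨_, hl⟩⟩

end OrthogonalityPreserving

/-- If `T` is a surjective orthogonality preserving bounded linear operator between unital
C*-algebras, then `h = T 1` is invertible, `h u*` is central (where `u` is the unitary polar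
factor of `h`), and `T = h u* S(·)` for a surjective bounded linear triple homomorphism `S`
with `ker S = ker T`. -/
theorem surjective_op_structure {A B : Type*} [CStarAlgebra A] [CStarAlgebra B]
    [PartialOrder B] [StarOrderedRing B] (T : A →L[ℂ] B) (hT : Function.Surjective T)
    (hop : ∀ a b : A, orth a b → orth (T a) (T b)) :
    IsUnit (T 1) ∧
      (∀ b : B, (T 1 * star (polarUnitary (T 1))) * b = b * (T 1 * star (polarUnitary (T 1)))) ∧
      ∃ S : A →L[ℂ] B, Function.Surjective S ∧
        (∀ x y z : A, S (tp x y z) = tp (S x) (S y) (S z)) ∧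
        (∀ x : A, S x = 0 ↔ T x = 0) ∧
        (∀ x : A, T x = T 1 * star (polarUnitary (T 1)) * S x) := by
  obtain ⟨v, hv⟩ := isUnit_map_one hT hop
  have hnormal := star_map_one_mul_map_one hT hop
  have hcomm := commute_star_map_one_mul_map_one hT hop
  have hq : 0 ≤ star (T 1) * T 1 := star_mul_self_nonneg _
  have hu : polarUnitary (T 1) = T 1 * Ring.inverse (CFC.sqrt (star (T 1) * T 1)) := rfl
  have hpp : CFC.sqrt (star (T 1) * T 1) * CFC.sqrt (star (T 1) * T 1) = star (T 1) * T 1 :=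
    CFC.sqrt_mul_sqrt_self _ hq
  have hps : star (CFC.sqrt (star (T 1) * T 1)) = CFC.sqrt (star (T 1) * T 1) :=
    (CFC.sqrt_nonneg _).isSelfAdjoint
  have hpc : ∀ b, Commute (CFC.sqrt (star (T 1) * T 1)) b := fun b => by
    rw [CFC.sqrt_eq_cfc]
    exact (hcomm b).cfc_nnreal _
  have hpu : IsUnit (CFC.sqrt (star (T 1) * T 1)) :=
    (CFC.isUnit_sqrt_iff _ hq).mpr ((hv ▸ v.isUnit).star.mul (hv ▸ v.isUnit))
  generalize CFC.sqrt (star (T 1) * T 1) = p at *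
  obtain ⟨w, rfl⟩ := hpu
  rw [Ring.inverse_unit] at hu
  have hrs : star (↑w⁻¹ : B) = ↑w⁻¹ := by
    rw [← Units.coe_star, star_inv, inv_inj.mpr (Units.ext hps)]
  have hrc : ∀ b, Commute (↑w⁻¹ : B) b := fun b => (hpc b).units_inv_left
  have hk : T 1 * star (polarUnitary (T 1)) = w := by
    rw [hu, star_mul, hrs, ← mul_assoc, ← (hrc _).eq, mul_assoc, ← hnormal, ← hpp,
      ← mul_assoc, Units.inv_mul, one_mul]
  have huu : star (polarUnitary (T 1)) * polarUnitary (T 1) = 1 := by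
    rw [hu, star_mul, hrs, mul_assoc, ← mul_assoc (star _), ← hpp, mul_assoc, Units.mul_inv,
      mul_one, Units.inv_mul]
  let J : A →ₗ[ℂ] B := (LinearMap.mulLeft ℂ (↑v⁻¹ : B)).comp T.toLinearMap
  have hJ : ∀ a, T a = T 1 * J a := fun a => by
    rw [← hv]
    exact (v.mul_inv_cancel_left _).symm
  have hcancel : ∀ {b c : B}, T 1 * b * star (T 1) = T 1 * c * star (T 1) → b = c := by
    intro b c h
    rw [← hv, ← Units.coe_star, Units.mul_left_inj, Units.mul_right_inj] at h
    exact h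
  have hJs : ∀ a, J (star a) = star (J a) := fun a => hcancel <| by
    rw [← hJ, map_mul_star_map_one hop, star_star, hJ a, star_mul, mul_assoc]
  have hJm : ∀ a b, J (a * b + b * a) = J a * J b + J b * J a := fun a b => hcancel <| by
    rw [← hJ, map_jordan_mul_star_map_one hop, hJ a, hJ b, hJ (star a), hJ (star b), hJs, hJs]
    simp only [star_mul, star_star, mul_add, add_mul, mul_assoc]
  have hS : ∀ a, ↑w⁻¹ * T a = polarUnitary (T 1) * J a := fun a => by
    rw [hJ a, hu, ← mul_assoc, (hrc _).eq]
  rw [hk]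
  refine ⟨hv ▸ v.isUnit, fun b => (hpc b).eq, (ContinuousLinearMap.mul ℂ B ↑w⁻¹).comp T,
    fun b => ?_, fun x y z => ?_, fun x => ?_, fun x => ?_⟩
  · obtain ⟨a, ha⟩ := hT (w * b)
    exact ⟨a, by simp [ha]⟩
  · simp only [ContinuousLinearMap.comp_apply, ContinuousLinearMap.mul_apply', hS]
    rw [map_tp_of_jordan J hJs hJm, mul_tp _ huu]
  · simp
  · simp
end
end
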